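/- Let (R, m) be a Noetherian local ring of Krull dimension d ≥ 1, and let J ⊆ R be an ideal which is not contained in any minimal prime ideal of R. Then there exist elements b₁, …, b_{d−1} ∈ m such that the quotient ring R/(b₁, …, b_{d−1}) has Krull dimension exactly 1 and the quotient ring R/(J + (b₁, …, b_{d−1})) has Krull dimension at most 0. -/

import Mathlib

open IsLocalRing in
lemma cut_dim {R : Type*} [CommRing R] [IsLocalRing R] (I K : Ideal R) (hIK : I ≤ K)
    (h : ∀ q ∈ I.minimalPrimes, q ≠ maximalIdeal R → ¬ K ≤ q) (n : ℕ)
    (hI : ringKrullDim (R ⧸ I) ≤ (n + 1 : ℕ)) : ringKrullDim (R ⧸ K) ≤ n := by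
  rw [ringKrullDim_quotient] at hI ⊢
  refine iSup_le fun p => ?_
  have hle : PrimeSpectrum.zeroLocus (K : Set R) ⊆ PrimeSpectrum.zeroLocus (I : Set R) :=
    PrimeSpectrum.zeroLocus_anti_mono hIK
  let q : LTSeries (PrimeSpectrum.zeroLocus (I : Set R)) :=
    p.map (Set.inclusion hle) (fun _ _ h => h)
  have hKp : K ≤ p.head.1.asIdeal := p.head.2
  have := p.head.1.2
  obtain ⟨r, hrm, hr⟩ := Ideal.exists_minimalPrimes_le (hIK.trans hKp)
  by_cases hrm' : r = maximalIdeal R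
  · have : p.length = 0 := by
      by_contra h0
      have hlt : p.head < p.last := p.strictMono (a := 0) (b := Fin.last _) (by
        rw [Fin.lt_def]; simpa using Nat.pos_of_ne_zero h0)
      have h1 : p.head.1.asIdeal < p.last.1.asIdeal := hlt
      exact absurd (le_maximalIdeal p.last.1.2.ne_top) (hrm' ▸ (lt_of_le_of_lt hr h1)).not_ge
    rw [this]
    exact_mod_cast Nat.zero_le n
  · let r' : PrimeSpectrum.zeroLocus (I : Set R) := ⟨⟨r, hrm.isPrime⟩, hrm.1.2⟩
    have hr' : r' < q.head := lt_of_le_of_ne hr (fun e => h r hrm hrm' (by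
      have : r = p.head.1.asIdeal := congrArg (fun z => z.1.asIdeal) e
      rw [this]; exact hKp))
    have h2 : ((q.cons r' hr').length : WithBot ℕ∞) ≤ (n + 1 : ℕ) :=
      (le_iSup (fun s : LTSeries _ => (s.length : WithBot ℕ∞)) _).trans hI
    have h3 : (q.cons r' hr').length = p.length + 1 := by
      rw [RelSeries.cons_length]; rfl
    rw [h3] at h2
    have h4 : p.length + 1 ≤ n + 1 := by exact_mod_cast h2
    have h5 : p.length ≤ n := by omega
    exact_mod_cast h5

open IsLocalRing in
lemma cut_exists {R : Type*} [CommRing R] [IsLocalRing R] [IsNoetherianRing R] (n : ℕ) :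
    ∀ (I K : Ideal R), ringKrullDim (R ⧸ I) ≤ (n + 1 : ℕ) → ringKrullDim (R ⧸ K) ≤ n →
    ∃ b : Fin n → R, (∀ i, b i ∈ maximalIdeal R) ∧
      ringKrullDim (R ⧸ (I ⊔ Ideal.span (Set.range b))) ≤ 1 ∧
      ringKrullDim (R ⧸ (K ⊔ Ideal.span (Set.range b))) ≤ 0 := by
  induction n with
  | zero =>
    intro I K hI hK
    refine ⟨Fin.elim0, fun i => i.elim0, ?_, ?_⟩
    · rw [Set.range_eq_empty, Ideal.span_empty, sup_bot_eq]; simpa using hI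
    · rw [Set.range_eq_empty, Ideal.span_empty, sup_bot_eq]; simpa using hK
  | succ n ih =>
    intro I K hI hK
    obtain ⟨x, hxm, hx⟩ : ∃ x ∈ maximalIdeal R,
        ∀ q ∈ I.minimalPrimes ∪ K.minimalPrimes, q ≠ maximalIdeal R → x ∉ q := by
      by_contra! hcon
      have hfin : ((I.minimalPrimes ∪ K.minimalPrimes) \ {maximalIdeal R}).Finite :=
        ((I.finite_minimalPrimes_of_isNoetherianRing R).union
          (K.finite_minimalPrimes_of_isNoetherianRing R)).sdiff
      have hpr : ∀ q ∈ (I.minimalPrimes ∪ K.minimalPrimes) \ {maximalIdeal R}, q.IsPrime := by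
        rintro q ⟨hq | hq, _⟩ <;> exact hq.isPrime
      obtain ⟨q, hq, hle⟩ := (Ideal.subset_union_prime_finite hfin (f := id) ⊥ ⊥
        (fun q hq _ _ => hpr q hq) (I := maximalIdeal R)).1 (fun x hx => by
          obtain ⟨q, hq, hne, hxq⟩ := hcon x hx
          exact Set.mem_biUnion (x := q) ⟨hq, hne⟩ hxq)
      exact hq.2 (le_antisymm (le_maximalIdeal (hpr q hq).ne_top) hle)
    have key : ∀ q : Ideal R, ∀ L : Ideal R, L ⊔ Ideal.span {x} ≤ q → x ∈ q := fun q L h =>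
      h (Ideal.mem_sup_right (Ideal.mem_span_singleton_self x))
    obtain ⟨b, hb, h1, h2⟩ := ih (I ⊔ Ideal.span {x}) (K ⊔ Ideal.span {x})
      (cut_dim I _ le_sup_left (fun q hq hne hle => hx q (.inl hq) hne (key q _ hle)) _ hI)
      (cut_dim K _ le_sup_left (fun q hq hne hle => hx q (.inr hq) hne (key q _ hle)) _ hK)
    refine ⟨Fin.cons x b, Fin.cases hxm hb, ?_, ?_⟩
    · rwa [Fin.range_cons, Ideal.span_insert, ← sup_assoc]
    · rwa [Fin.range_cons, Ideal.span_insert, ← sup_assoc]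


/-- In a Noetherian local ring `(R, m)` of Krull dimension `d ≥ 1`, if `J` is an ideal
not contained in any minimal prime of `R`, then there are `b₁, …, b_{d-1} ∈ m` such that
`R/(b₁, …, b_{d-1})` has Krull dimension exactly `1` and `R/(J + (b₁, …, b_{d-1}))` has
Krull dimension at most `0`. -/
theorem exists_cutting_sequence_to_curve
    (R : Type*) [CommRing R] [IsNoetherianRing R] [IsLocalRing R]
    (d : ℕ) (hd : 1 ≤ d) (hdim : ringKrullDim R = d)
    (J : Ideal R) (hJ : ∀ p ∈ minimalPrimes R, ¬ J ≤ p) :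
    ∃ b : Fin (d - 1) → R,
      (∀ i, b i ∈ IsLocalRing.maximalIdeal R) ∧
      ringKrullDim (R ⧸ Ideal.span (Set.range b)) = 1 ∧
      ringKrullDim (R ⧸ (J ⊔ Ideal.span (Set.range b))) ≤ 0 := by
  obtain ⟨n, rfl⟩ : ∃ n, d = n + 1 := ⟨d - 1, by omega⟩
  have e : ringKrullDim (R ⧸ (⊥ : Ideal R)) = ringKrullDim R :=
    ringKrullDim_eq_of_ringEquiv (RingEquiv.quotientBot R)
  have hI : ringKrullDim (R ⧸ (⊥ : Ideal R)) ≤ (n + 1 : ℕ) := by rw [e, hdim]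
  obtain ⟨b, hb, h1, h2⟩ := cut_exists n ⊥ J hI
    (cut_dim ⊥ J bot_le (fun q hq _ => hJ q hq) n hI)
  rw [bot_sup_eq] at h1
  refine ⟨b, hb, le_antisymm h1 ?_, h2⟩
  have h3 := ringKrullDim_le_ringKrullDim_quotient_add_encard (Set.range b) (by
    rintro _ ⟨i, rfl⟩
    rw [IsLocalRing.ringJacobson_eq_maximalIdeal]
    exact hb i)
  have h4 : (Set.range b).encard ≤ n := by
    rw [← Set.image_univ]
    exact (Set.encard_image_le _ _).trans (by simp)
  have h5 : ((n + 1 : ℕ) : WithBot ℕ∞) ≤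
      ringKrullDim (R ⧸ Ideal.span (Set.range b)) + (n : ℕ∞) := by
    rw [← hdim]
    refine h3.trans ?_
    gcongr
    exact WithBot.coe_le_coe.mpr h4
  by_contra hlt
  have h6 : ringKrullDim (R ⧸ Ideal.span (Set.range b)) ≤ 0 := by
    generalize ringKrullDim (R ⧸ Ideal.span (Set.range b)) = x at hlt
    induction x with
    | bot => exact bot_le
    | coe x =>
      have h9 : x < 1 := by
        rw [not_le] at hlt
        exact_mod_cast hlt
      rw [Order.lt_one_iff] at h9
      simp [h9]
  have h7 : ((n + 1 : ℕ) : WithBot ℕ∞) ≤ 0 + (n : ℕ∞) := h5.trans (by gcongr)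
  rw [zero_add] at h7
  have h8 : n + 1 ≤ n := by exact_mod_cast h7
  omega
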